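/- Let φ^(e) be the exponential Euler function, the multiplicative function with φ^(e)(p^ν) = ∑_{κ|ν} μ(ν/κ) p^κ. Then liminf_{n→∞} φ^(e)(n)·log log n / n = e^{-γ}. -/

import Mathlib

open Filter Real ArithmeticFunction

/-- Chebyshev's identity: the logarithm of `N!` as a sum over the primes up to `N`. -/
lemma log_factorial_eq_sum_primesLE (N : ℕ) :
    Real.log (N.factorial : ℝ) =
      ∑ p ∈ N.primesLE, (N.factorial.factorization p : ℝ) * Real.log p := by
  rw [Real.log_nat_eq_sum_factorization, Finsupp.sum]
  refine Finset.sum_subset (fun p hp => ?_) (fun p _ hp => ?_)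
  · have h := Nat.support_factorization N.factorial ▸ hp
    have hp' := Nat.prime_of_mem_primeFactors h
    exact Nat.mem_primesLE.2 ⟨(hp'.dvd_factorial).1 (Nat.dvd_of_mem_primeFactors h), hp'⟩
  · simp [Finsupp.notMem_support_iff.1 hp]

lemma log_factorial_le_mul_sum (N : ℕ) :
    Real.log (N.factorial : ℝ) ≤ N * ∑ p ∈ N.primesLE, Real.log p / (p - 1) := by
  rw [log_factorial_eq_sum_primesLE, Finset.mul_sum]
  refine Finset.sum_le_sum fun p hp => ?_
  have hp' := (Nat.mem_primesLE.1 hp).2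
  have := Fact.mk hp'
  have h1 : (1 : ℝ) < p := by exact_mod_cast hp'.one_lt
  have key : (p - 1) * N.factorial.factorization p ≤ N := by
    rw [Nat.factorization_def _ hp', sub_one_mul_padicValNat_factorial]
    exact Nat.sub_le _ _
  have key' : ((p : ℝ) - 1) * N.factorial.factorization p ≤ N := by
    have := (Nat.cast_le (α := ℝ)).2 key
    rwa [Nat.cast_mul, Nat.cast_sub hp'.one_lt.le, Nat.cast_one] at this
  have h2 : 0 ≤ Real.log p := Real.log_nonneg h1.le
  have h3 : 0 < (p : ℝ) - 1 := by linarith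
  rw [mul_div_assoc', le_div_iff₀ h3]
  nlinarith [mul_le_mul_of_nonneg_right key' h2]

lemma mul_sum_sub_theta_le_log_factorial (N : ℕ) :
    N * ∑ p ∈ N.primesLE, Real.log p / p - Chebyshev.theta N ≤ Real.log (N.factorial : ℝ) := by
  rw [log_factorial_eq_sum_primesLE, Finset.mul_sum, Chebyshev.theta_eq_sum_primesLE_log,
    ← Finset.sum_sub_distrib]
  refine Finset.sum_le_sum fun p hp => ?_
  obtain ⟨hpN, hp'⟩ := Nat.mem_primesLE.1 hp
  have h1 : (1 : ℝ) < p := by exact_mod_cast hp'.one_lt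
  have h2 : 0 ≤ Real.log p := Real.log_nonneg h1.le
  have key : N / p ≤ N.factorial.factorization p := by
    rw [Nat.factorization_factorial hp' (Nat.lt_succ_self _)]
    have hmem : 1 ∈ Finset.Ico 1 (Nat.log p N).succ :=
      Finset.mem_Ico.2 ⟨le_rfl, Nat.succ_lt_succ (Nat.log_pos hp'.one_lt hpN)⟩
    simpa using Finset.single_le_sum (f := fun i => N / p ^ i) (fun _ _ => Nat.zero_le _) hmem
  have key' : (N : ℝ) / p - 1 ≤ N.factorial.factorization p := by
    have h := Nat.sub_one_lt_floor ((N : ℝ) / p)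
    rw [Nat.floor_div_natCast, Nat.floor_natCast] at h
    exact h.le.trans (by exact_mod_cast key)
  calc N * (Real.log p / p) - Real.log p = (N / p - 1) * Real.log p := by ring
    _ ≤ _ := mul_le_mul_of_nonneg_right key' h2

lemma summable_log_div_mul_sub_one :
    Summable fun n : ℕ => Real.log n / ((n : ℝ) * (n - 1)) := by
  refine Summable.of_nonneg_of_le (fun n => ?_) (fun n => ?_)
    ((Real.summable_nat_rpow.2 (by norm_num : (-3 / 2 : ℝ) < -1)).mul_left 4)
  · rcases Nat.eq_zero_or_pos n with rfl | hn
    · simp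
    · have : (1 : ℝ) ≤ n := by exact_mod_cast hn
      exact div_nonneg (Real.log_nonneg this) (mul_nonneg (by linarith) (by linarith))
  · rcases lt_or_ge n 2 with hn | hn
    · interval_cases n <;> norm_num
    · have h2 : (2 : ℝ) ≤ n := by exact_mod_cast hn
      have h0 : (0 : ℝ) < n := by linarith
      have hl := Real.log_le_rpow_div h0.le (by norm_num : (0 : ℝ) < 1 / 2)
      rw [div_le_iff₀ (by nlinarith)]
      have e : (n : ℝ) ^ (1 / 2 : ℝ) = n ^ (-3 / 2 : ℝ) * (n * n) := by
        rw [← pow_two, ← Real.rpow_natCast (n : ℝ) 2, ← Real.rpow_add h0]; norm_num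
      have h3 : 0 < (n : ℝ) ^ (-3 / 2 : ℝ) := Real.rpow_pos_of_pos h0 _
      rw [e] at hl
      have h4 : (n : ℝ) * n ≤ 2 * (n * (n - 1)) := by nlinarith
      nlinarith [mul_le_mul_of_nonneg_left h4 h3.le]

lemma inv_le_neg_log_one_sub_inv {x : ℝ} (hx : 1 < x) :
    x⁻¹ ≤ -Real.log (1 - x⁻¹) := by
  have h : 0 < 1 - x⁻¹ := sub_pos.2 (inv_lt_one_of_one_lt₀ hx)
  linarith [Real.log_le_sub_one_of_pos h]

lemma neg_log_one_sub_inv_le {x : ℝ} (hx : 1 < x) :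
    -Real.log (1 - x⁻¹) ≤ (x - 1)⁻¹ := by
  have h : 0 < 1 - x⁻¹ := sub_pos.2 (inv_lt_one_of_one_lt₀ hx)
  have h1 := Real.one_sub_inv_le_log_of_pos h
  have : (1 - x⁻¹)⁻¹ = 1 + (x - 1)⁻¹ := by
    have : x - 1 ≠ 0 := by linarith
    field_simp
    ring
  linarith

/-- Mertens' first theorem, with the weights `-log (1 - 1/p)` in place of `1/p`. -/
lemma exists_abs_sum_neg_log_mul_log_sub_log_le :
    ∃ K : ℝ, ∀ N : ℕ, 1 ≤ N →
      |∑ p ∈ N.primesLE, -Real.log (1 - (p : ℝ)⁻¹) * Real.log p - Real.log N| ≤ K := by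
  set K := ∑' n : ℕ, Real.log n / ((n : ℝ) * (n - 1)) with hK
  refine ⟨K + 2, fun N hN => ?_⟩
  have hN0 : (0 : ℝ) < N := by exact_mod_cast hN
  set T := ∑ p ∈ N.primesLE, -Real.log (1 - (p : ℝ)⁻¹) * Real.log p
  set U := ∑ p ∈ N.primesLE, Real.log p / ((p : ℝ) - 1) with hU
  set V := ∑ p ∈ N.primesLE, Real.log p / (p : ℝ) with hV
  have hp1 : ∀ p ∈ N.primesLE, (1 : ℝ) < p := fun p hp => by
    exact_mod_cast (Nat.mem_primesLE.1 hp).2.one_lt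
  have hVT : V ≤ T := Finset.sum_le_sum fun p hp => by
    rw [div_eq_inv_mul]
    exact mul_le_mul_of_nonneg_right (inv_le_neg_log_one_sub_inv (hp1 p hp))
      (Real.log_nonneg (hp1 p hp).le)
  have hTU : T ≤ U := Finset.sum_le_sum fun p hp => by
    rw [div_eq_inv_mul]
    exact mul_le_mul_of_nonneg_right (neg_log_one_sub_inv_le (hp1 p hp))
      (Real.log_nonneg (hp1 p hp).le)
  have hUV : U ≤ V + K := by
    rw [← sub_le_iff_le_add', hU, hV, ← Finset.sum_sub_distrib]
    refine le_trans (le_of_eq (Finset.sum_congr rfl fun p hp => ?_))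
      (summable_log_div_mul_sub_one.sum_le_tsum N.primesLE fun n _ => ?_)
    · have := hp1 p hp
      have h1 : (p : ℝ) - 1 ≠ 0 := by linarith
      have h2 : (p : ℝ) ≠ 0 := by linarith
      field_simp
      ring
    · rcases Nat.eq_zero_or_pos n with rfl | hn
      · simp
      · have : (1 : ℝ) ≤ n := by exact_mod_cast hn
        exact div_nonneg (Real.log_nonneg this) (mul_nonneg (by linarith) (by linarith))
  have hlow : N * Real.log N - N ≤ Real.log (N.factorial : ℝ) := by
    have h := Stirling.le_log_factorial_stirling (n := N) (by omega)
    have h1 : 0 ≤ Real.log N := Real.log_nonneg (by exact_mod_cast hN)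
    have h2 : 0 ≤ Real.log (2 * π) := Real.log_nonneg (by linarith [Real.pi_gt_three])
    linarith
  have hupp : Real.log (N.factorial : ℝ) ≤ N * Real.log N := by
    rw [← Real.log_pow]
    exact Real.log_le_log (by exact_mod_cast N.factorial_pos)
      (by exact_mod_cast Nat.factorial_le_pow N)
  have hU' : Real.log N - 1 ≤ U :=
    le_of_mul_le_mul_left (by linarith [log_factorial_le_mul_sum N]) hN0
  have hV' : V ≤ Real.log N + Real.log 4 := by
    have h1 := mul_sum_sub_theta_le_log_factorial N
    have h2 := Chebyshev.theta_le_log4_mul_x hN0.le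
    exact le_of_mul_le_mul_left (by linarith) hN0
  have hl4 : Real.log 4 ≤ 2 := by
    rw [show (4 : ℝ) = 2 ^ 2 by norm_num, Real.log_pow]
    have := Real.log_two_lt_d9
    push_cast
    linarith
  rw [abs_le]
  constructor <;> linarith

/-- The summand `-log (1 - 1/n)` supported on the primes. -/
noncomputable def primeLogTerm (n : ℕ) : ℝ :=
  if n.Prime then -Real.log (1 - (n : ℝ)⁻¹) else 0

/-- The function taking the value `1 / k` at `2 ^ k` for `1 ≤ k`, and zero elsewhere. -/
noncomputable def powTwoTerm (n : ℕ) : ℝ :=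
  if 2 ^ Nat.log 2 n = n then (Nat.log 2 n : ℝ)⁻¹ else 0

lemma sum_range_ite_pow_log (g : ℕ → ℝ) {N : ℕ} (hN : N ≠ 0) :
    ∑ i ∈ Finset.range (N + 1), (if 2 ^ Nat.log 2 i = i then g (Nat.log 2 i) else 0) =
      ∑ k ∈ Finset.range (Nat.log 2 N + 1), g k := by
  rw [← Finset.sum_filter]
  have : (Finset.range (N + 1)).filter (fun i => 2 ^ Nat.log 2 i = i) =
      (Finset.range (Nat.log 2 N + 1)).image (2 ^ ·) := by
    ext i
    simp only [Finset.mem_filter, Finset.mem_range, Finset.mem_image, Nat.lt_succ_iff]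
    constructor
    · rintro ⟨h1, h2⟩
      exact ⟨_, Nat.log_mono_right h1, h2⟩
    · rintro ⟨k, hk, rfl⟩
      exact ⟨Nat.pow_le_of_le_log hN hk, by rw [Nat.log_pow one_lt_two]⟩
  rw [this, Finset.sum_image fun a _ b _ h => Nat.pow_right_injective le_rfl h]
  exact Finset.sum_congr rfl fun k _ => by rw [Nat.log_pow one_lt_two]

lemma sum_range_powTwoTerm {N : ℕ} (hN : N ≠ 0) :
    ∑ i ∈ Finset.range (N + 1), powTwoTerm i = harmonic (Nat.log 2 N) := by
  simp only [powTwoTerm]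
  rw [sum_range_ite_pow_log (fun k => (k : ℝ)⁻¹) hN, Finset.sum_range_succ', harmonic]
  simp

lemma sum_range_powTwoTerm_mul_log {N : ℕ} (hN : N ≠ 0) :
    ∑ i ∈ Finset.range (N + 1), powTwoTerm i * Real.log i = Nat.log 2 N * Real.log 2 := by
  have h : ∀ i : ℕ, powTwoTerm i * Real.log i =
      if 2 ^ Nat.log 2 i = i then (fun k : ℕ => (k : ℝ)⁻¹ * (k * Real.log 2)) (Nat.log 2 i)
        else 0 := by
    intro i
    unfold powTwoTerm
    split_ifs with hi
    · conv_lhs => rw [← hi]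
      rw [Nat.log_pow one_lt_two]
      push_cast
      rw [Real.log_pow]
    · simp
  rw [Finset.sum_congr rfl fun i _ => h i,
    sum_range_ite_pow_log (fun k : ℕ => (k : ℝ)⁻¹ * (k * Real.log 2)) hN, Finset.sum_range_succ']
  have h2 : ∀ k : ℕ, ((k + 1 : ℕ) : ℝ)⁻¹ * ((k + 1 : ℕ) * Real.log 2) = Real.log 2 := fun k => by
    have : ((k + 1 : ℕ) : ℝ) ≠ 0 := by positivity
    field_simp
  simp only [h2]
  simp

lemma natLog_two_mul_log_two_le {N : ℕ} (hN : N ≠ 0) : Nat.log 2 N * Real.log 2 ≤ Real.log N := by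
  rw [← Real.log_pow]
  exact Real.log_le_log (by positivity) (by exact_mod_cast Nat.pow_log_le_self 2 hN)

lemma log_le_natLog_two_add_one_mul {N : ℕ} (hN : N ≠ 0) :
    Real.log N ≤ (Nat.log 2 N + 1) * Real.log 2 := by
  have h : Real.log N ≤ Real.log ((2 : ℝ) ^ (Nat.log 2 N + 1)) :=
    Real.log_le_log (by positivity)
      (by exact_mod_cast (Nat.lt_pow_succ_log_self one_lt_two N).le)
  rwa [Real.log_pow, Nat.cast_add, Nat.cast_one] at h

lemma sum_range_primeLogTerm (N : ℕ) :
    ∑ i ∈ Finset.range (N + 1), primeLogTerm i =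
      ∑ p ∈ N.primesLE, -Real.log (1 - (p : ℝ)⁻¹) := by
  simp only [primeLogTerm]
  rw [← Finset.sum_filter, Nat.primesLE_eq_filter_range]

lemma sum_range_primeLogTerm_mul_log (N : ℕ) :
    ∑ i ∈ Finset.range (N + 1), primeLogTerm i * Real.log i =
      ∑ p ∈ N.primesLE, -Real.log (1 - (p : ℝ)⁻¹) * Real.log p := by
  simp only [primeLogTerm, ite_mul, zero_mul]
  rw [← Finset.sum_filter, Nat.primesLE_eq_filter_range]

lemma exists_tendsto_sum_range_sub :
    ∃ L : ℝ, Tendsto (fun n => ∑ i ∈ Finset.range n, (primeLogTerm i - powTwoTerm i)) atTop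
      (nhds L) := by
  obtain ⟨K, hK⟩ := exists_abs_sum_neg_log_mul_log_sub_log_le
  have hK0 : 0 ≤ K := (abs_nonneg _).trans (hK 1 le_rfl)
  have hl2 : 0 < Real.log 2 := Real.log_pos one_lt_two
  have hanti : Antitone fun n : ℕ => (Real.log (max (n : ℝ) 2))⁻¹ := fun m n hmn => by
    have h2 : (0 : ℝ) < max (m : ℝ) 2 := lt_max_of_lt_right two_pos
    refine inv_anti₀ (Real.log_pos (lt_max_of_lt_right one_lt_two)) (Real.log_le_log h2 ?_)
    exact max_le_max_right _ (by exact_mod_cast hmn)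
  have hzero : Tendsto (fun n : ℕ => (Real.log (max (n : ℝ) 2))⁻¹) atTop (nhds 0) :=
    (Real.tendsto_log_atTop.comp (tendsto_atTop_mono (fun n => le_max_left _ _)
      tendsto_natCast_atTop_atTop)).inv_tendsto_atTop
  have hbdd : ∀ n : ℕ, ‖∑ i ∈ Finset.range n, (primeLogTerm i - powTwoTerm i) * Real.log i‖ ≤
      K + Real.log 2 := by
    intro n
    rcases n with _ | N
    · simpa using by positivity
    rcases Nat.eq_zero_or_pos N with rfl | hN
    · simpa using by positivity
    simp only [sub_mul]
    rw [Finset.sum_sub_distrib, sum_range_primeLogTerm_mul_log,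
      sum_range_powTwoTerm_mul_log hN.ne', Real.norm_eq_abs, abs_le]
    have h1 := abs_le.1 (hK N hN)
    have h2 := natLog_two_mul_log_two_le hN.ne'
    have h3 := log_le_natLog_two_add_one_mul hN.ne'
    constructor <;> linarith
  have h := hanti.cauchySeq_series_mul_of_tendsto_zero_of_bounded hzero hbdd
  obtain ⟨L, hL⟩ := cauchySeq_tendsto_of_complete h
  refine ⟨L, hL.congr fun n => Finset.sum_congr rfl fun i _ => ?_⟩
  rcases lt_or_ge i 2 with hi | hi
  · interval_cases i <;> simp [primeLogTerm, powTwoTerm, Nat.not_prime_zero, Nat.not_prime_one]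
  · have h2 : (2 : ℝ) ≤ i := by exact_mod_cast hi
    have h3 : Real.log i ≠ 0 := (Real.log_pos (by linarith)).ne'
    rw [max_eq_left h2, smul_eq_mul]
    field_simp

/-- Abel's inequality. -/
lemma abs_sum_range_mul_sub_le {c v : ℕ → ℝ} {ε : ℝ} (hv : Antitone v)
    (hc : ∀ n, |∑ i ∈ Finset.range n, c i| ≤ ε) (n : ℕ) :
    |∑ i ∈ Finset.range n, c i * v i - (∑ i ∈ Finset.range n, c i) * v n| ≤ ε * (v 0 - v n) := by
  induction n with
  | zero => simp
  | succ n ih =>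
    have e : ∑ i ∈ Finset.range (n + 1), c i * v i
          - (∑ i ∈ Finset.range (n + 1), c i) * v (n + 1)
        = (∑ i ∈ Finset.range n, c i * v i - (∑ i ∈ Finset.range n, c i) * v n)
          + (∑ i ∈ Finset.range (n + 1), c i) * (v n - v (n + 1)) := by
      rw [Finset.sum_range_succ, Finset.sum_range_succ]
      ring
    have h0 : 0 ≤ v n - v (n + 1) := sub_nonneg.2 (hv n.le_succ)
    rw [e]
    calc _ ≤ ε * (v 0 - v n) + ε * (v n - v (n + 1)) := by
          refine (abs_add_le _ _).trans (add_le_add ih ?_)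
          rw [abs_mul, abs_of_nonneg h0]
          exact mul_le_mul_of_nonneg_right (hc _) h0
      _ = _ := by ring

lemma abs_sum_range_mul_le {c v : ℕ → ℝ} {ε : ℝ} (hv : Antitone v) (hv0 : ∀ n, 0 ≤ v n)
    (hv1 : v 0 ≤ 1) (hc : ∀ n, |∑ i ∈ Finset.range n, c i| ≤ ε) (n : ℕ) :
    |∑ i ∈ Finset.range n, c i * v i| ≤ ε := by
  have h1 := abs_sum_range_mul_sub_le hv hc n
  have h2 : |(∑ i ∈ Finset.range n, c i) * v n| ≤ ε * v n := by
    rw [abs_mul, abs_of_nonneg (hv0 n)]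
    exact mul_le_mul_of_nonneg_right (hc n) (hv0 n)
  have hε : 0 ≤ ε := (abs_nonneg _).trans (hc 0)
  have h3 := abs_add_le (∑ i ∈ Finset.range n, c i * v i - (∑ i ∈ Finset.range n, c i) * v n)
    ((∑ i ∈ Finset.range n, c i) * v n)
  rw [sub_add_cancel] at h3
  nlinarith

/-- Abel's limit theorem for a family of decreasing weights. -/
lemma tendsto_of_hasSum_mul_of_tendsto_sum {ι : Type*} {l : Filter ι} {c : ℕ → ℝ}
    {v : ι → ℕ → ℝ} {F : ι → ℝ} {L : ℝ}
    (hc : Tendsto (fun n => ∑ i ∈ Finset.range n, c i) atTop (nhds L))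
    (hv : ∀ᶠ δ in l, Antitone (v δ)) (hv0 : ∀ᶠ δ in l, ∀ n, 0 ≤ v δ n)
    (hv1 : ∀ᶠ δ in l, v δ 0 ≤ 1) (hvt : ∀ n, Tendsto (fun δ => v δ n) l (nhds 1))
    (hF : ∀ᶠ δ in l, HasSum (fun n => c n * v δ n) (F δ)) :
    Tendsto F l (nhds L) := by
  rw [Metric.tendsto_nhds]
  intro ε hε
  obtain ⟨M, hM⟩ := Metric.cauchySeq_iff.1 hc.cauchySeq (ε / 4) (by positivity)
  have hML : |∑ i ∈ Finset.range M, c i - L| ≤ ε / 4 := by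
    refine le_of_tendsto ((hc.const_sub _).abs) ?_
    filter_upwards [eventually_ge_atTop M] with n hn
    exact (hM M le_rfl n hn).le
  have hfin : Tendsto (fun δ => ∑ i ∈ Finset.range M, c i * v δ i) l
      (nhds (∑ i ∈ Finset.range M, c i)) := by
    simpa using tendsto_finsetSum (Finset.range M) fun i _ => (hvt i).const_mul (c i)
  filter_upwards [hv, hv0, hv1, hF, Metric.tendsto_nhds.1 hfin (ε / 4) (by positivity)]
    with δ h1 h2 h3 h4 h5
  have htail : |F δ - ∑ i ∈ Finset.range M, c i * v δ i| ≤ ε / 4 := by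
    refine le_of_tendsto ((h4.tendsto_sum_nat.sub_const _).abs) ?_
    filter_upwards [eventually_ge_atTop M] with n hn
    obtain ⟨k, rfl⟩ := Nat.exists_eq_add_of_le hn
    rw [Finset.sum_range_add, add_sub_cancel_left]
    refine abs_sum_range_mul_le (c := fun i => c (M + i)) (v := fun i => v δ (M + i))
      (fun a b hab => h1 (by omega)) (fun n => h2 _) ((h1 (Nat.zero_le _)).trans h3)
      (fun m => ?_) k
    have := hM (M + m) (by omega) M le_rfl
    rw [Real.dist_eq, Finset.sum_range_add, add_sub_cancel_left] at this
    exact this.le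
  rw [Real.dist_eq] at h5 ⊢
  have e : F δ - L = (F δ - ∑ i ∈ Finset.range M, c i * v δ i) +
    (∑ i ∈ Finset.range M, c i * v δ i - ∑ i ∈ Finset.range M, c i) +
    (∑ i ∈ Finset.range M, c i - L) := by ring
  rw [e]
  refine lt_of_le_of_lt ((abs_add_le _ _).trans (add_le_add_left (abs_add_le _ _) _)) ?_
  linarith

lemma hasSum_powTwoTerm_mul_rpow {δ : ℝ} (hδ : 0 < δ) :
    HasSum (fun n : ℕ => powTwoTerm n * (max (n : ℝ) 1) ^ (-δ))
      (-Real.log (1 - (2 : ℝ) ^ (-δ))) := by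
  have hinj : Function.Injective fun k : ℕ => 2 ^ (k + 1) := fun a b h => by
    simpa using Nat.pow_right_injective le_rfl h
  have hx : |(2 : ℝ) ^ (-δ)| < 1 := by
    rw [abs_of_pos (by positivity)]
    exact Real.rpow_lt_one_of_one_lt_of_neg one_lt_two (neg_neg_of_pos hδ)
  rw [← hinj.hasSum_iff]
  · convert Real.hasSum_pow_div_log_of_abs_lt_one hx using 2 with k
    have h1 : (1 : ℝ) ≤ 2 ^ (k + 1) := one_le_pow₀ one_le_two
    simp only [Function.comp_apply, powTwoTerm]
    rw [Nat.log_pow one_lt_two, if_pos rfl]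
    push_cast
    rw [max_eq_left h1, ← Real.rpow_natCast, ← Real.rpow_natCast, ← Real.rpow_mul two_pos.le,
      ← Real.rpow_mul two_pos.le, mul_comm (-δ)]
    ring
  · intro n hn
    simp only [powTwoTerm]
    split_ifs with h
    · have h0 : Nat.log 2 n = 0 := by
        by_contra h0
        exact hn ⟨Nat.log 2 n - 1, by simpa [Nat.sub_add_cancel (Nat.pos_of_ne_zero h0)] using h⟩
      simp [h0]
    · simp

/-- The summand of the logarithm of the Euler product of `ζ (1 + δ)`. -/
noncomputable def logEulerTerm (δ : ℝ) (n : ℕ) : ℝ :=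
  if n.Prime then -Real.log (1 - ((n : ℝ) ^ (1 + δ))⁻¹) else 0

lemma abs_primeLogTerm_mul_sub_logEulerTerm_le {δ : ℝ} (hδ : 0 < δ) (n : ℕ) :
    |primeLogTerm n * (max (n : ℝ) 1) ^ (-δ) - logEulerTerm δ n| ≤ 2 * (n : ℝ) ^ (-2 : ℝ) := by
  unfold primeLogTerm logEulerTerm
  split_ifs with hp
  swap
  · simp only [zero_mul, sub_zero, abs_zero]
    positivity
  have h2 : (2 : ℝ) ≤ n := by exact_mod_cast hp.two_le
  have h0 : (0 : ℝ) < n := by linarith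
  have hm : (n : ℝ) ≤ (n : ℝ) ^ (1 + δ) := by
    conv_lhs => rw [← Real.rpow_one (n : ℝ)]
    exact Real.rpow_le_rpow_of_exponent_le (by linarith) (by linarith)
  rw [max_eq_left (by linarith)]
  have hy : (n : ℝ) ^ (-δ) = n * ((n : ℝ) ^ (1 + δ))⁻¹ := by
    rw [Real.rpow_add h0, Real.rpow_neg h0.le, Real.rpow_one]
    have : (n : ℝ) ^ δ ≠ 0 := (Real.rpow_pos_of_pos h0 _).ne'
    field_simp
  rw [hy]
  set m := (n : ℝ) ^ (1 + δ)
  have hm0 : 0 < m := by linarith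
  have a1 := inv_le_neg_log_one_sub_inv (x := n) (by linarith)
  have a2 := neg_log_one_sub_inv_le (x := n) (by linarith)
  have b1 := inv_le_neg_log_one_sub_inv (x := m) (by linarith)
  have b2 := neg_log_one_sub_inv_le (x := m) (by linarith)
  set A := -Real.log (1 - (n : ℝ)⁻¹)
  set B := -Real.log (1 - m⁻¹)
  have hnm : 0 < (n : ℝ) * m⁻¹ := by positivity
  have c1 : m⁻¹ ≤ A * (n * m⁻¹) := by
    have := mul_le_mul_of_nonneg_right a1 hnm.le
    rwa [inv_mul_cancel_left₀ h0.ne'] at this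
  have c2 : A * (n * m⁻¹) ≤ m⁻¹ + m⁻¹ * ((n : ℝ) - 1)⁻¹ := by
    have := mul_le_mul_of_nonneg_right a2 hnm.le
    refine this.trans (le_of_eq ?_)
    have : (n : ℝ) - 1 ≠ 0 := by linarith
    field_simp
    ring
  have d2 : (m - 1)⁻¹ = m⁻¹ + m⁻¹ * (m - 1)⁻¹ := by
    have : m - 1 ≠ 0 := by linarith
    field_simp
    ring
  have hb : m⁻¹ * ((n : ℝ) - 1)⁻¹ ≤ 2 * (n : ℝ) ^ (-2 : ℝ) := by
    have e : 2 * (n : ℝ) ^ (-2 : ℝ) = (n : ℝ)⁻¹ * ((n : ℝ) / 2)⁻¹ := by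
      rw [Real.rpow_neg h0.le, Real.rpow_two]
      field_simp
    rw [e]
    exact mul_le_mul (inv_anti₀ h0 hm) (inv_anti₀ (by linarith) (by linarith))
      (inv_nonneg.2 (by linarith)) (by positivity)
  have hmn : m⁻¹ * (m - 1)⁻¹ ≤ m⁻¹ * ((n : ℝ) - 1)⁻¹ :=
    mul_le_mul_of_nonneg_left (inv_anti₀ (by linarith) (by linarith)) (by positivity)
  rw [abs_le]
  constructor <;> linarith

lemma summable_logEulerTerm {δ : ℝ} (hδ : 0 < δ) : Summable (logEulerTerm δ) := by
  refine Summable.of_nonneg_of_le (fun n => ?_) (fun n => ?_)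
    ((Real.summable_nat_rpow.2 (by linarith : -(1 + δ) < -1)).mul_left 2)
  all_goals
    unfold logEulerTerm
    split_ifs with hp
    swap
    · positivity
    have h2 : (2 : ℝ) ≤ n := by exact_mod_cast hp.two_le
    have hm : (n : ℝ) ≤ (n : ℝ) ^ (1 + δ) := by
      conv_lhs => rw [← Real.rpow_one (n : ℝ)]
      exact Real.rpow_le_rpow_of_exponent_le (by linarith) (by linarith)
  · exact le_trans (inv_nonneg.2 (by linarith)) (inv_le_neg_log_one_sub_inv (by linarith))
  · refine (neg_log_one_sub_inv_le (by linarith)).trans ?_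
    rw [Real.rpow_neg (by linarith), ← div_eq_mul_inv, inv_eq_one_div,
      div_le_div_iff₀ (by linarith) (by linarith)]
    linarith

lemma summable_two_mul_rpow_neg_two : Summable fun n : ℕ => 2 * (n : ℝ) ^ (-2 : ℝ) :=
  (Real.summable_nat_rpow.2 (by norm_num)).mul_left 2

lemma tendsto_tsum_primeLogTerm_sub_logEulerTerm :
    Tendsto (fun δ : ℝ => ∑' n : ℕ, (primeLogTerm n * (max (n : ℝ) 1) ^ (-δ) - logEulerTerm δ n))
      (nhdsWithin 0 (Set.Ioi 0)) (nhds 0) := by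
  have h := tendsto_tsum_of_dominated_convergence (𝓕 := nhdsWithin (0 : ℝ) (Set.Ioi 0))
    (f := fun δ n => primeLogTerm n * (max (n : ℝ) 1) ^ (-δ) - logEulerTerm δ n)
    (g := fun _ : ℕ => (0 : ℝ)) summable_two_mul_rpow_neg_two (fun n => ?_) ?_
  · simpa using h
  · refine tendsto_nhdsWithin_of_tendsto_nhds ?_
    unfold primeLogTerm logEulerTerm
    split_ifs with hp
    swap
    · simp
    have h2 : (2 : ℝ) ≤ n := by exact_mod_cast hp.two_le
    have h0 : (n : ℝ) ≠ 0 := by linarith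
    have h3 : 1 - (n : ℝ)⁻¹ ≠ 0 := by
      have := inv_lt_one_of_one_lt₀ (by linarith : (1 : ℝ) < n)
      linarith
    rw [max_eq_left (by linarith)]
    have hc : ContinuousAt (fun δ : ℝ => -Real.log (1 - (n : ℝ)⁻¹) * (n : ℝ) ^ (-δ) -
        -Real.log (1 - ((n : ℝ) ^ (1 + δ))⁻¹)) 0 := by
      have c1 : ContinuousAt (fun δ : ℝ => (n : ℝ) ^ (-δ)) 0 :=
        (Real.continuousAt_const_rpow h0).comp continuousAt_neg
      have c2 : ContinuousAt (fun δ : ℝ => (n : ℝ) ^ (1 + δ)) 0 :=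
        (Real.continuousAt_const_rpow h0).comp (by fun_prop)
      refine (continuousAt_const.mul c1).sub (ContinuousAt.neg (ContinuousAt.log
        (continuousAt_const.sub (c2.inv₀ ?_)) ?_))
      · simpa using hp.ne_zero
      · simpa using h3
    simpa [ContinuousAt] using hc
  · filter_upwards [self_mem_nhdsWithin] with δ hδ n
    exact abs_primeLogTerm_mul_sub_logEulerTerm_le hδ n

lemma exp_tsum_logEulerTerm {δ : ℝ} (hδ : 0 < δ) :
    ((Real.exp (∑' n, logEulerTerm δ n) : ℝ) : ℂ) = riemannZeta (1 + δ) := by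
  rw [← riemannZeta_eulerProduct_exp_log (by simpa using hδ), Complex.ofReal_exp]
  congr 1
  have h : ∑' n, logEulerTerm δ n = ∑' p : Nat.Primes, -Real.log (1 - ((p : ℝ) ^ (1 + δ))⁻¹) := by
    refine Eq.trans ?_ (tsum_subtype {p : ℕ | p.Prime}
      (fun n : ℕ => -Real.log (1 - ((n : ℝ) ^ (1 + δ))⁻¹))).symm
    refine tsum_congr fun n => ?_
    simp [logEulerTerm, Set.indicator_apply]
  rw [h, Complex.ofReal_tsum]
  refine tsum_congr fun p => ?_
  have h2 : (2 : ℝ) ≤ p := by exact_mod_cast p.2.two_le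
  have hm : (p : ℝ) ≤ (p : ℝ) ^ (1 + δ) := by
    conv_lhs => rw [← Real.rpow_one (p : ℝ)]
    exact Real.rpow_le_rpow_of_exponent_le (by linarith) (by linarith)
  have h3 := inv_lt_one_of_one_lt₀ (by linarith : 1 < (p : ℝ) ^ (1 + δ))
  rw [Complex.ofReal_neg, Complex.ofReal_log (by linarith), Complex.ofReal_sub,
    Complex.ofReal_one, Complex.ofReal_inv, Complex.ofReal_cpow (by linarith),
    Complex.cpow_neg]
  simp

lemma tendsto_tsum_logEulerTerm_add_log :
    Tendsto (fun δ : ℝ => (∑' n, logEulerTerm δ n) + Real.log δ)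
      (nhdsWithin 0 (Set.Ioi 0)) (nhds 0) := by
  have hmap : Tendsto (fun δ : ℝ => (1 + δ : ℂ)) (nhdsWithin 0 (Set.Ioi 0))
      (nhdsWithin 1 {1}ᶜ) := by
    refine tendsto_nhdsWithin_iff.2 ⟨tendsto_nhdsWithin_of_tendsto_nhds ?_, ?_⟩
    · have : Continuous fun δ : ℝ => (1 + δ : ℂ) := by fun_prop
      simpa using this.tendsto 0
    · filter_upwards [self_mem_nhdsWithin] with δ hδ
      have : δ ≠ 0 := ne_of_gt hδ
      simpa using this
  have h := (Complex.continuous_re.tendsto _).comp (riemannZeta_residue_one.comp hmap)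
  have h1 : Tendsto (fun δ : ℝ => δ * Real.exp (∑' n, logEulerTerm δ n))
      (nhdsWithin 0 (Set.Ioi 0)) (nhds 1) := by
    refine (Complex.one_re ▸ h).congr' ?_
    filter_upwards [self_mem_nhdsWithin] with δ hδ
    simp only [Function.comp_apply]
    rw [← exp_tsum_logEulerTerm hδ, add_sub_cancel_left, ← Complex.ofReal_mul, Complex.ofReal_re]
  have h2 := h1.log one_ne_zero
  rw [Real.log_one] at h2
  refine h2.congr' ?_
  filter_upwards [self_mem_nhdsWithin] with δ hδ
  rw [Real.log_mul (ne_of_gt hδ) (Real.exp_pos _).ne', Real.log_exp, add_comm]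

lemma tendsto_log_one_sub_two_rpow_sub_log :
    Tendsto (fun δ : ℝ => Real.log (1 - (2 : ℝ) ^ (-δ)) - Real.log δ)
      (nhdsWithin 0 (Set.Ioi 0)) (nhds (Real.log (Real.log 2))) := by
  have hl2 : 0 < Real.log 2 := Real.log_pos one_lt_two
  have hd : HasDerivAt (fun δ : ℝ => 1 - (2 : ℝ) ^ (-δ)) (Real.log 2) 0 := by
    have := (((hasDerivAt_id (0 : ℝ)).neg).const_rpow (two_pos (α := ℝ))).const_sub 1
    simpa using this
  have h := (hasDerivAt_iff_tendsto_slope_zero.1 hd).mono_left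
    (nhdsWithin_mono 0 (fun x (hx : 0 < x) => ne_of_gt hx))
  refine (h.log hl2.ne').congr' ?_
  filter_upwards [self_mem_nhdsWithin] with δ hδ
  have hx : (2 : ℝ) ^ (-δ) < 1 := Real.rpow_lt_one_of_one_lt_of_neg one_lt_two (neg_neg_of_pos hδ)
  simp only [zero_add, neg_zero, Real.rpow_zero, sub_self, sub_zero, smul_eq_mul]
  rw [Real.log_mul (inv_ne_zero (ne_of_gt hδ)) (by linarith), Real.log_inv]
  ring

lemma tendsto_sum_range_primeLogTerm_sub_powTwoTerm :
    Tendsto (fun n => ∑ i ∈ Finset.range n, (primeLogTerm i - powTwoTerm i)) atTop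
      (nhds (Real.log (Real.log 2))) := by
  obtain ⟨L, hL⟩ := exists_tendsto_sum_range_sub
  have habel := tendsto_of_hasSum_mul_of_tendsto_sum (l := nhdsWithin (0 : ℝ) (Set.Ioi 0))
    (v := fun δ n => (max (n : ℝ) 1) ^ (-δ))
    (F := fun δ => (∑' n : ℕ, (primeLogTerm n * (max (n : ℝ) 1) ^ (-δ) - logEulerTerm δ n)) +
      ∑' n, logEulerTerm δ n - -Real.log (1 - (2 : ℝ) ^ (-δ))) hL ?_ ?_ ?_ ?_ ?_
  · have h := (tendsto_tsum_primeLogTerm_sub_logEulerTerm.add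
      tendsto_tsum_logEulerTerm_add_log).add tendsto_log_one_sub_two_rpow_sub_log
    rw [add_zero, zero_add] at h
    have := tendsto_nhds_unique habel (h.congr fun δ => by ring)
    rwa [this] at hL
  · filter_upwards [self_mem_nhdsWithin] with δ hδ a b hab
    exact Real.rpow_le_rpow_of_nonpos (lt_max_of_lt_right one_pos)
      (max_le_max_right _ (by exact_mod_cast hab)) (neg_nonpos.2 (le_of_lt hδ))
  · exact Eventually.of_forall fun δ n => Real.rpow_nonneg (le_max_of_le_right zero_le_one) _
  · exact Eventually.of_forall fun δ => by simp
  · intro n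
    have h : Continuous fun δ : ℝ => (max (n : ℝ) 1) ^ (-δ) :=
      (Real.continuous_const_rpow (lt_max_of_lt_right one_pos).ne').comp continuous_neg
    have := h.tendsto 0
    rw [neg_zero, Real.rpow_zero] at this
    exact tendsto_nhdsWithin_of_tendsto_nhds this
  · filter_upwards [self_mem_nhdsWithin] with δ hδ
    have hs : Summable fun n : ℕ => primeLogTerm n * (max (n : ℝ) 1) ^ (-δ) - logEulerTerm δ n :=
      Summable.of_norm_bounded summable_two_mul_rpow_neg_two
        (abs_primeLogTerm_mul_sub_logEulerTerm_le hδ)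
    have h := (hs.hasSum.add (summable_logEulerTerm hδ).hasSum).sub (hasSum_powTwoTerm_mul_rpow hδ)
    simpa [sub_mul] using h

lemma tendsto_natLog_two_atTop : Tendsto (fun N : ℕ => Nat.log 2 N) atTop atTop :=
  tendsto_atTop_atTop.2 fun b => ⟨2 ^ b, fun _ ha =>
    (Nat.log_pow one_lt_two b).symm.le.trans (Nat.log_mono_right ha)⟩

lemma tendsto_log_div_natLog_two :
    Tendsto (fun N : ℕ => Real.log N / Nat.log 2 N) atTop (nhds (Real.log 2)) := by
  have hinv : Tendsto (fun N : ℕ => ((Nat.log 2 N : ℕ) : ℝ)⁻¹) atTop (nhds 0) :=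
    (tendsto_natCast_atTop_atTop.comp tendsto_natLog_two_atTop).inv_tendsto_atTop
  have hup : Tendsto (fun N : ℕ => (1 + ((Nat.log 2 N : ℕ) : ℝ)⁻¹) * Real.log 2) atTop
      (nhds (Real.log 2)) := by
    simpa using (hinv.const_add 1).mul_const (Real.log 2)
  refine tendsto_of_tendsto_of_tendsto_of_le_of_le' tendsto_const_nhds hup ?_ ?_
  all_goals
    filter_upwards [eventually_ge_atTop 2] with N hN
    have hk : (0 : ℝ) < (Nat.log 2 N : ℕ) := by exact_mod_cast Nat.log_pos one_lt_two hN
  · rw [le_div_iff₀ hk, mul_comm]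
    exact natLog_two_mul_log_two_le (by omega)
  · rw [div_le_iff₀ hk]
    refine (log_le_natLog_two_add_one_mul (by omega)).trans (le_of_eq ?_)
    field_simp

/-- Mertens' third theorem. -/
theorem tendsto_prod_primesLE_mul_log :
    Tendsto (fun N : ℕ => (∏ p ∈ N.primesLE, (1 - (p : ℝ)⁻¹)) * Real.log N) atTop
      (nhds (Real.exp (-Real.eulerMascheroniConstant))) := by
  have hl2 : 0 < Real.log 2 := Real.log_pos one_lt_two
  have h1 := tendsto_sum_range_primeLogTerm_sub_powTwoTerm.comp (tendsto_add_atTop_nat 1)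
  have h2 := Real.tendsto_harmonic_sub_log.comp tendsto_natLog_two_atTop
  have h3 := tendsto_log_div_natLog_two.log hl2.ne'
  have h4 := (Real.continuous_exp.tendsto _).comp (h3.sub (h1.add h2))
  rw [sub_add_cancel_left] at h4
  refine h4.congr' ?_
  filter_upwards [eventually_ge_atTop 2] with N hN
  have hk : (0 : ℝ) < (Nat.log 2 N : ℕ) := by exact_mod_cast Nat.log_pos one_lt_two hN
  have hlog : 0 < Real.log N := Real.log_pos (by exact_mod_cast hN)
  simp only [Function.comp_apply]
  rw [Finset.sum_sub_distrib, sum_range_powTwoTerm (by omega), sum_range_primeLogTerm,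
    Real.log_div hlog.ne' hk.ne', Finset.sum_neg_distrib, ← Real.log_prod]
  · have hpos : 0 < ∏ p ∈ N.primesLE, (1 - (p : ℝ)⁻¹) := Finset.prod_pos fun p hp =>
      sub_pos.2 (inv_lt_one_of_one_lt₀ (by exact_mod_cast (Nat.mem_primesLE.1 hp).2.one_lt))
    rw [← Real.exp_log hpos, ← Real.exp_log hlog, ← Real.exp_add, Real.exp_log hpos,
      Real.exp_log hlog]
    congr 1
    ring
  · intro p hp
    have := inv_lt_one_of_one_lt₀
      (by exact_mod_cast (Nat.mem_primesLE.1 hp).2.one_lt : (1 : ℝ) < p)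
    linarith

lemma prime_pow_mul_one_sub_inv_le_sum_moebius {p ν : ℕ} (hp : p.Prime) (hν : 1 ≤ ν) :
    (p : ℝ) ^ ν * (1 - (p : ℝ)⁻¹) ≤
      ∑ κ ∈ ν.divisors, ((moebius (ν / κ) : ℤ) : ℝ) * (p : ℝ) ^ κ := by
  have h2 : (2 : ℝ) ≤ p := by exact_mod_cast hp.two_le
  have h0 : (p : ℝ) ≠ 0 := by linarith
  have hsub : (p : ℝ) ^ ν * (1 - (p : ℝ)⁻¹) = (p : ℝ) ^ ν - (p : ℝ) ^ (ν - 1) := by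
    rw [mul_sub, mul_one, pow_sub₀ _ h0 hν, pow_one]
  rw [hsub, ← Nat.insert_self_properDivisors (by omega),
    Finset.sum_insert Nat.self_notMem_properDivisors, Nat.div_self (by omega)]
  simp only [moebius_apply_one, Int.cast_one, one_mul]
  suffices h : |∑ κ ∈ ν.properDivisors, ((moebius (ν / κ) : ℤ) : ℝ) * (p : ℝ) ^ κ| ≤
      (p : ℝ) ^ (ν - 1) by
    linarith [(abs_le.1 h).1]
  have hterm : |∑ κ ∈ ν.properDivisors, ((moebius (ν / κ) : ℤ) : ℝ) * (p : ℝ) ^ κ| ≤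
      ∑ κ ∈ ν.properDivisors, (p : ℝ) ^ κ := by
    refine (Finset.abs_sum_le_sum_abs _ _).trans (Finset.sum_le_sum fun κ _ => ?_)
    rw [abs_mul, abs_of_nonneg (by positivity : (0 : ℝ) ≤ (p : ℝ) ^ κ)]
    have h1 : |((moebius (ν / κ) : ℤ) : ℝ)| ≤ 1 := by exact_mod_cast abs_moebius_le_one
    exact mul_le_of_le_one_left (by positivity) h1
  refine hterm.trans ?_
  rcases eq_or_ne ν 2 with rfl | hν2
  · rw [Nat.Prime.properDivisors Nat.prime_two]
    simp
  · have hlt : ∀ κ ∈ ν.properDivisors, κ < ν - 1 := by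
      intro κ hκ
      obtain ⟨⟨c, hc⟩, hlt⟩ := Nat.mem_properDivisors.1 hκ
      have hc2 : 2 ≤ c := by
        by_contra hc2
        have : c = 0 ∨ c = 1 := by omega
        rcases this with rfl | rfl <;> simp at hc <;> omega
      have : κ * 2 ≤ ν := hc ▸ Nat.mul_le_mul_left κ hc2
      have hκ0 : 0 < κ := Nat.pos_of_mem_properDivisors hκ
      omega
    exact_mod_cast (Nat.geomSum_lt hp.two_le hlt).le

lemma one_sub_inv_prime_mem_Icc {p : ℕ} (hp : p.Prime) :
    0 ≤ 1 - (p : ℝ)⁻¹ ∧ 1 - (p : ℝ)⁻¹ ≤ 1 := by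
  have h : (1 : ℝ) < p := by exact_mod_cast hp.one_lt
  have h1 := inv_lt_one_of_one_lt₀ h
  have h2 : (0 : ℝ) < (p : ℝ)⁻¹ := inv_pos.2 (by linarith)
  constructor <;> linarith

lemma mul_prod_primeFactors_le_of_multiplicative {f : ℕ → ℝ} (h1 : f 1 = 1)
    (hm : ∀ m n : ℕ, Nat.Coprime m n → f (m * n) = f m * f n)
    (hpp : ∀ p ν : ℕ, p.Prime → 1 ≤ ν → (p : ℝ) ^ ν * (1 - (p : ℝ)⁻¹) ≤ f (p ^ ν))
    {n : ℕ} (hn : n ≠ 0) :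
    n * ∏ p ∈ n.primeFactors, (1 - (p : ℝ)⁻¹) ≤ f n := by
  rw [Nat.multiplicative_factorization f hm h1 hn]
  have hn' : (n : ℝ) = ∏ p ∈ n.primeFactors, (p : ℝ) ^ n.factorization p := by
    conv_lhs => rw [← Nat.prod_factorization_pow_eq_self hn]
    rw [Finsupp.prod, Nat.support_factorization]
    push_cast
    rfl
  rw [hn', Finsupp.prod, Nat.support_factorization, ← Finset.prod_mul_distrib]
  refine Finset.prod_le_prod (fun p hp => ?_) fun p hp => ?_
  · exact mul_nonneg (by positivity)
      (one_sub_inv_prime_mem_Icc (Nat.prime_of_mem_primeFactors hp)).1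
  · have hp' := Nat.prime_of_mem_primeFactors hp
    exact hpp p _ hp' (hp'.factorization_pos_of_dvd hn (Nat.dvd_of_mem_primeFactors hp))

lemma card_primeFactors_filter_mul_log_le {n : ℕ} (hn : n ≠ 0) (m : ℕ) :
    ((n.primeFactors.filter (m < ·)).card : ℝ) * Real.log (m + 1) ≤ Real.log n := by
  set T := n.primeFactors.filter (m < ·) with hT
  have h1 : (m + 1) ^ T.card ≤ n := by
    refine (Finset.pow_card_le_prod (s := T) (f := fun p => p) (n := m + 1) fun p hp => ?_).trans ?_
    · exact (Finset.mem_filter.1 hp).2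
    · exact Nat.le_of_dvd (Nat.pos_of_ne_zero hn) ((Finset.prod_dvd_prod_of_subset _ _ _
        (Finset.filter_subset _ _)).trans (Nat.prod_primeFactors_dvd n))
  rw [← Real.log_pow]
  exact Real.log_le_log (by positivity) (by exact_mod_cast h1)

lemma prod_primesLE_mul_le_prod_primeFactors {n m : ℕ} (hn : n ≠ 0) (hm : 1 ≤ m)
    (hnm : Real.log n ≤ m + 1) :
    (∏ p ∈ m.primesLE, (1 - (p : ℝ)⁻¹)) * (1 - (m + 1) / (m * Real.log (m + 1))) ≤
      ∏ p ∈ n.primeFactors, (1 - (p : ℝ)⁻¹) := by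
  have hm1 : (1 : ℝ) ≤ m := by exact_mod_cast hm
  set S := n.primeFactors.filter (¬ m < ·) with hS
  set T := n.primeFactors.filter (m < ·) with hT
  have hSmem : S ⊆ m.primesLE := fun p hp => by
    obtain ⟨h1, h2⟩ := Finset.mem_filter.1 hp
    exact Nat.mem_primesLE.2 ⟨not_lt.1 h2, Nat.prime_of_mem_primeFactors h1⟩
  have hP0 : 0 ≤ ∏ p ∈ m.primesLE, (1 - (p : ℝ)⁻¹) := Finset.prod_nonneg fun p hp =>
    (one_sub_inv_prime_mem_Icc (Nat.mem_primesLE.1 hp).2).1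
  have hT0 : 0 ≤ ∏ p ∈ T, (1 - (p : ℝ)⁻¹) := Finset.prod_nonneg fun p hp =>
    (one_sub_inv_prime_mem_Icc (Nat.prime_of_mem_primeFactors (Finset.mem_filter.1 hp).1)).1
  have hPS : ∏ p ∈ m.primesLE, (1 - (p : ℝ)⁻¹) ≤ ∏ p ∈ S, (1 - (p : ℝ)⁻¹) := by
    rw [← Finset.prod_sdiff hSmem]
    refine mul_le_of_le_one_left (Finset.prod_nonneg fun p hp => ?_)
      (Finset.prod_le_one (fun p hp => ?_) fun p hp => ?_)
    · exact (one_sub_inv_prime_mem_Icc (Nat.mem_primesLE.1 (hSmem hp)).2).1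
    all_goals
      have := one_sub_inv_prime_mem_Icc (Nat.mem_primesLE.1 (Finset.mem_sdiff.1 hp).1).2
    · exact this.1
    · exact this.2
  have hTlow : 1 - (m + 1) / (m * Real.log (m + 1)) ≤ ∏ p ∈ T, (1 - (p : ℝ)⁻¹) := by
    have hl : 0 < Real.log (m + 1) := Real.log_pos (by linarith)
    have hcard : (T.card : ℝ) ≤ (m + 1) / Real.log (m + 1) := by
      rw [le_div_iff₀ hl]
      exact (card_primeFactors_filter_mul_log_le hn m).trans hnm
    have hinv : (m : ℝ)⁻¹ ≤ 1 := inv_le_one_of_one_le₀ hm1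
    calc 1 - (m + 1) / (m * Real.log (m + 1))
        = 1 + (m + 1) / Real.log (m + 1) * (-(m : ℝ)⁻¹) := by field_simp; ring
      _ ≤ 1 + T.card * (-(m : ℝ)⁻¹) := by
          have := mul_le_mul_of_nonneg_right hcard (inv_nonneg.2 (by linarith : (0 : ℝ) ≤ m))
          linarith
      _ ≤ (1 + -(m : ℝ)⁻¹) ^ T.card := one_add_mul_le_pow (by linarith) _
      _ ≤ _ := by
          rw [← Finset.prod_const]
          refine Finset.prod_le_prod (fun _ _ => by linarith) fun p hp => ?_
          have hmp : (m : ℝ) ≤ p := by exact_mod_cast (Finset.mem_filter.1 hp).2.le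
          have := inv_anti₀ (by linarith) hmp
          linarith
  rw [← Finset.prod_filter_mul_prod_filter_not n.primeFactors (m < ·), mul_comm (∏ p ∈ T, _)]
  exact (mul_le_mul_of_nonneg_left hTlow hP0).trans (mul_le_mul_of_nonneg_right hPS hT0)

lemma tendsto_prod_primesLE_mul_log_mul :
    Tendsto (fun m : ℕ => (∏ p ∈ m.primesLE, (1 - (p : ℝ)⁻¹)) *
      (1 - (m + 1) / (m * Real.log (m + 1))) * Real.log m) atTop
      (nhds (Real.exp (-Real.eulerMascheroniConstant))) := by
  have h1 : Tendsto (fun m : ℕ => (Real.log ((m : ℝ) + 1))⁻¹) atTop (nhds 0) :=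
    (Real.tendsto_log_atTop.comp (tendsto_atTop_add_const_right _ 1
      tendsto_natCast_atTop_atTop)).inv_tendsto_atTop
  have h2 : Tendsto (fun m : ℕ => 1 + (m : ℝ)⁻¹) atTop (nhds 1) := by
    simpa using (tendsto_natCast_atTop_atTop (R := ℝ)).inv_tendsto_atTop.const_add 1
  have h3 := tendsto_prod_primesLE_mul_log.mul ((h2.mul h1).const_sub 1)
  rw [mul_zero, sub_zero, mul_one] at h3
  refine h3.congr' ?_
  filter_upwards [eventually_ge_atTop 1] with m hm
  have hm0 : (0 : ℝ) < m := by exact_mod_cast hm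
  have e : ((m : ℝ) + 1) / (m * Real.log (m + 1)) = (1 + (m : ℝ)⁻¹) * (Real.log (m + 1))⁻¹ := by
    rw [div_eq_mul_inv, mul_inv, ← mul_assoc, add_mul, mul_inv_cancel₀ hm0.ne', one_mul]
  rw [e]
  ring

lemma map_prod_sq_of_multiplicative {f : ℕ → ℝ} (h1 : f 1 = 1)
    (hm : ∀ m n : ℕ, Nat.Coprime m n → f (m * n) = f m * f n) {s : Finset ℕ}
    (hs : ∀ p ∈ s, p.Prime) : f (∏ p ∈ s, p ^ 2) = ∏ p ∈ s, f (p ^ 2) := by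
  induction s using Finset.induction_on with
  | empty => simpa using h1
  | insert q s hq ih =>
    rw [Finset.prod_insert hq, Finset.prod_insert hq, hm, ih fun p hp =>
      hs p (Finset.mem_insert_of_mem hp)]
    refine Nat.Coprime.prod_right fun p hp => Nat.Coprime.pow 2 2 ?_
    refine (Nat.coprime_primes (hs q (Finset.mem_insert_self _ _))
      (hs p (Finset.mem_insert_of_mem hp))).2 ?_
    rintro rfl
    exact hq hp

lemma tendsto_prod_primesLE_sq_atTop :
    Tendsto (fun m : ℕ => ∏ p ∈ m.primesLE, p ^ 2) atTop atTop := by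
  refine tendsto_atTop_atTop.2 fun b => ?_
  obtain ⟨q, hbq, hq⟩ := Nat.exists_infinite_primes b
  refine ⟨q, fun m hm => hbq.trans ?_⟩
  have hpos : 0 < ∏ p ∈ m.primesLE, p ^ 2 :=
    Finset.prod_pos fun p hp => pow_pos (Nat.mem_primesLE.1 hp).2.pos 2
  exact Nat.le_of_dvd hpos ((dvd_pow_self q two_ne_zero).trans
    (Finset.dvd_prod_of_mem (fun p => p ^ 2) (Nat.mem_primesLE.2 ⟨hm, hq⟩)))

lemma log_log_prod_primesLE_sq_le {m : ℕ} (hm : 2 ≤ m) :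
    Real.log (Real.log ((∏ p ∈ m.primesLE, p ^ 2 : ℕ) : ℝ)) ≤
      Real.log (2 * Real.log 4) + Real.log m := by
  have hm0 : (2 : ℝ) ≤ m := by exact_mod_cast hm
  have e : Real.log ((∏ p ∈ m.primesLE, p ^ 2 : ℕ) : ℝ) = 2 * Chebyshev.theta m := by
    push_cast
    rw [Real.log_prod fun p hp => pow_ne_zero 2
      (Nat.cast_ne_zero.2 (Nat.mem_primesLE.1 hp).2.ne_zero),
      Chebyshev.theta_eq_sum_primesLE_log, Finset.mul_sum]
    simp
  have h4 : 0 < Real.log 4 := Real.log_pos (by norm_num)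
  rw [e, ← Real.log_mul (by positivity) (by linarith)]
  refine Real.log_le_log (by linarith [Chebyshev.theta_pos hm0]) ?_
  linarith [Chebyshev.theta_le_log4_mul_x (x := m) (by linarith)]

lemma tendsto_prod_primesLE_mul_const_add_log (C : ℝ) :
    Tendsto (fun m : ℕ => (∏ p ∈ m.primesLE, (1 - (p : ℝ)⁻¹)) * (C + Real.log m)) atTop
      (nhds (Real.exp (-Real.eulerMascheroniConstant))) := by
  have h1 : Tendsto (fun m : ℕ => (Real.log (m : ℝ))⁻¹) atTop (nhds 0) :=
    (Real.tendsto_log_atTop.comp tendsto_natCast_atTop_atTop).inv_tendsto_atTop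
  have h := tendsto_prod_primesLE_mul_log.mul ((h1.const_mul C).add_const 1)
  rw [mul_zero, zero_add, mul_one] at h
  refine h.congr' ?_
  filter_upwards [eventually_ge_atTop 2] with m hm
  have : Real.log m ≠ 0 := (Real.log_pos (by exact_mod_cast hm)).ne'
  field_simp

/-- **Exponential Euler function.** If `φᵉ` is the multiplicative function with
`φᵉ(p^ν) = ∑_{κ ∣ ν} μ(ν/κ) p^κ`, then `liminf φᵉ(n) log log n / n = e^{-γ}`. -/
theorem liminf_exponential_phi_eq
    (φe : ℕ → ℝ) (h1 : φe 1 = 1)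
    (hm : ∀ m n : ℕ, Nat.Coprime m n → φe (m * n) = φe m * φe n)
    (hpp : ∀ p ν : ℕ, p.Prime → 1 ≤ ν →
      φe (p ^ ν) = ∑ κ ∈ ν.divisors, ((moebius (ν / κ) : ℤ) : ℝ) * (p : ℝ) ^ κ) :
    Filter.liminf (fun n : ℕ => φe n * Real.log (Real.log n) / n) Filter.atTop =
      Real.exp (-Real.eulerMascheroniConstant) := by
  set E := Real.exp (-Real.eulerMascheroniConstant)
  have hfloor : Tendsto (fun n : ℕ => ⌊Real.log n⌋₊) atTop atTop :=
    tendsto_nat_floor_atTop.comp (Real.tendsto_log_atTop.comp tendsto_natCast_atTop_atTop)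
  have hlower : ∀ a < E, ∀ᶠ n : ℕ in atTop, a ≤ φe n * Real.log (Real.log n) / n := by
    intro a ha
    filter_upwards [(tendsto_prod_primesLE_mul_log_mul.comp hfloor).eventually_const_lt ha,
      hfloor.eventually_ge_atTop 1, eventually_ge_atTop 1] with n hn hfl hn1
    have hn0 : (0 : ℝ) < n := by exact_mod_cast hn1
    refine hn.le.trans ?_
    simp only [Function.comp_apply]
    set m := ⌊Real.log n⌋₊
    have hm1 : (1 : ℝ) ≤ m := by exact_mod_cast hfl
    have hmn : (m : ℝ) ≤ Real.log n := Nat.floor_le (Real.log_natCast_nonneg n)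
    have hQ0 : 0 ≤ ∏ p ∈ n.primeFactors, (1 - (p : ℝ)⁻¹) := Finset.prod_nonneg fun p hp =>
      (one_sub_inv_prime_mem_Icc (Nat.prime_of_mem_primeFactors hp)).1
    have hlog : Real.log m ≤ Real.log (Real.log n) := Real.log_le_log (by linarith) hmn
    have hlogm : 0 ≤ Real.log m := Real.log_nonneg hm1
    have hφ := mul_prod_primeFactors_le_of_multiplicative h1 hm
      (fun p ν hp hν => (hpp p ν hp hν).symm ▸ prime_pow_mul_one_sub_inv_le_sum_moebius hp hν)
      (n := n) (by omega)
    rw [mul_div_right_comm]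
    calc _ ≤ (∏ p ∈ n.primeFactors, (1 - (p : ℝ)⁻¹)) * Real.log m :=
          mul_le_mul_of_nonneg_right (prod_primesLE_mul_le_prod_primeFactors (by omega) hfl
            (Nat.lt_floor_add_one _).le) hlogm
      _ ≤ (∏ p ∈ n.primeFactors, (1 - (p : ℝ)⁻¹)) * Real.log (Real.log n) :=
          mul_le_mul_of_nonneg_left hlog hQ0
      _ ≤ _ := by
          refine mul_le_mul_of_nonneg_right ?_ (hlogm.trans hlog)
          rwa [le_div_iff₀' hn0]
  have hupper : ∀ b > E, ∃ᶠ n : ℕ in atTop, φe n * Real.log (Real.log n) / n ≤ b := by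
    intro b hb
    refine tendsto_prod_primesLE_sq_atTop.frequently (Eventually.frequently ?_)
    filter_upwards [(tendsto_prod_primesLE_mul_const_add_log
      (Real.log (2 * Real.log 4))).eventually_lt_const hb, eventually_ge_atTop 2] with m hm' hm2
    refine le_trans ?_ hm'.le
    have hprime : ∀ p ∈ m.primesLE, p.Prime := fun p hp => (Nat.mem_primesLE.1 hp).2
    have hquot : φe (∏ p ∈ m.primesLE, p ^ 2) / ((∏ p ∈ m.primesLE, p ^ 2 : ℕ) : ℝ) =
        ∏ p ∈ m.primesLE, (1 - (p : ℝ)⁻¹) := by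
      rw [map_prod_sq_of_multiplicative h1 hm hprime, Nat.cast_prod, ← Finset.prod_div_distrib]
      refine Finset.prod_congr rfl fun p hp => ?_
      have hp0 : (p : ℝ) ≠ 0 := Nat.cast_ne_zero.2 (hprime p hp).ne_zero
      rw [hpp p 2 (hprime p hp) one_le_two, Nat.Prime.sum_divisors Nat.prime_two]
      simp [moebius_apply_prime Nat.prime_two]
      field_simp
      ring
    rw [mul_div_right_comm, hquot]
    exact mul_le_mul_of_nonneg_left (log_log_prod_primesLE_sq_le hm2)
      (Finset.prod_nonneg fun p hp => (one_sub_inv_prime_mem_Icc (hprime p hp)).1)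
  refine le_antisymm (le_of_forall_gt_imp_ge_of_dense fun b hb => ?_)
    (le_of_forall_lt_imp_le_of_dense fun a ha => ?_)
  · exact liminf_le_of_frequently_le (hupper b hb)
      (isBoundedUnder_of_eventually_ge (hlower (E - 1) (by linarith)))
  · exact le_liminf_of_le (IsCoboundedUnder.of_frequently_le (hupper (E + 1) (by linarith)))
      (hlower a ha)
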